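/- arXiv:0810.5185 — 2 statements merged into one kernel-verified Lean document; each statement's English description precedes it below -/
import Mathlib

section
/- Let Λ be a non-semisimple Artin algebra, n ≥ 1, and M a generator-cogenerator of mod Λ. Suppose that for each finitely generated Λ-module X there exists an exact sequence 0 → M_n → ⋯ → M_1 → X → 0 with all M_i ∈ add M, such that applying Hom_Λ(L, −) for any L ∈ add M yields an exact sequence 0 → Hom(L, M_n) → ⋯ → Hom(L, M_1) → Hom(L, X) → 0. Then the global dimension of End_Λ(M) is at most n + 1. -/
open CategoryTheory
universe u

/-- A short exact sequence `0 → X → E → Y → 0` of `R`-modules. -/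
structure ModSES (R : Type u) [Ring R] (X E Y : ModuleCat.{u} R) where
  i : X ⟶ E
  p : E ⟶ Y
  inj : Function.Injective i
  surj : Function.Surjective p
  exact : Function.Exact i p

/-- A short exact sequence splits. -/
def ModSES.Splits {R : Type u} [Ring R] {X E Y : ModuleCat.{u} R}
    (s : ModSES R X E Y) : Prop :=
  ∃ r : E ⟶ X, s.i ≫ r = 𝟙 X

/-- `Ext¹(Y, X) = 0`: every extension of `Y` by `X` splits. -/
def Ext1Zero (R : Type u) [Ring R] (Y X : ModuleCat.{u} R) : Prop :=
  ∀ (E : ModuleCat.{u} R) (s : ModSES R X E Y), s.Splits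

/-- `N` belongs to `add M`: it is a direct summand of a finite direct sum of copies of `M`. -/
def InAdd (R : Type u) [Ring R] (M N : ModuleCat.{u} R) : Prop :=
  ∃ (n : ℕ) (s : N ⟶ ModuleCat.of R (Fin n → M)) (r : ModuleCat.of R (Fin n → M) ⟶ N),
    s ≫ r = 𝟙 N

/-- `f : C_M ⟶ X` is a right `𝒞`-approximation. -/
def IsRightApprox (R : Type u) [Ring R] (𝒞 : ModuleCat.{u} R → Prop)
    {CM X : ModuleCat.{u} R} (f : CM ⟶ X) : Prop :=
  𝒞 CM ∧ ∀ C : ModuleCat.{u} R, 𝒞 C → ∀ g : C ⟶ X, ∃ h : C ⟶ CM, h ≫ f = g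

/-- A morphism is right minimal. -/
def RightMinimal {R : Type u} [Ring R] {E X : ModuleCat.{u} R} (f : E ⟶ X) : Prop :=
  ∀ g : E ⟶ E, g ≫ f = f → Function.Bijective g

/-- Projective dimension at most `n`, via projective resolutions. -/
def pdLE (R : Type u) [Ring R] : ℕ → ModuleCat.{u} R → Prop
  | 0, N => Projective N
  | (n+1), N => ∃ (P K : ModuleCat.{u} R) (ι : K ⟶ P) (π : P ⟶ N),
      Projective P ∧ Function.Injective ι ∧ Function.Surjective π ∧ Function.Exact ι π ∧
        pdLE R n K

/-- Global dimension at most `n` (tested on finitely generated modules). -/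
def gldimLE (R : Type u) [Ring R] (n : ℕ) : Prop :=
  ∀ N : ModuleCat.{u} R, Module.Finite R N → pdLE R n N

/-- The global dimension, as an element of `ℕ∞`. -/
noncomputable def gldim (R : Type u) [Ring R] : ℕ∞ :=
  sInf {d : ℕ∞ | ∃ n : ℕ, d = n ∧ gldimLE R n}

/-- An indecomposable module: nonzero, and `0, id` are the only idempotent endomorphisms. -/
def Indec {R : Type u} [Ring R] (M : ModuleCat.{u} R) : Prop :=
  Nontrivial M ∧ ∀ f : M ⟶ M, f ≫ f = f → f = 0 ∨ f = 𝟙 M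

/-- `M` is a generator-cogenerator of `mod R`. -/
def IsGenCogen (R : Type u) [Ring R] (M : ModuleCat.{u} R) : Prop :=
  InAdd R M (ModuleCat.of R R) ∧
    ∀ I : ModuleCat.{u} R, Module.Finite R I → Injective I → InAdd R M I

/-- The representation dimension is at most `n`. -/
def repdimLE (R : Type u) [Ring R] (n : ℕ) : Prop :=
  ∃ M : ModuleCat.{u} R, Module.Finite R M ∧ IsGenCogen R M ∧
    gldimLE (Module.End R M) n

section CharacterDual

variable {R : Type u} [Ring R]

/-- The right module of characters of a left module: `Hom_ℤ(A, ℚ/ℤ)`. -/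
abbrev CharDual (A : Type u) [AddCommGroup A] : Type u := A →+ AddCircle (1 : ℚ)

variable {A B C : Type u} [AddCommGroup A] [AddCommGroup B] [AddCommGroup C]

theorem CharDual.exists_extension (f : A →+ B) (hf : Function.Injective f) (χ : CharDual A) :
    ∃ ψ : CharDual B, ψ.comp f = χ :=
  (Module.Baer.of_divisible _).extension_property_addMonoidHom f hf χ

/-- A character vanishing on the kernel of `f` factors through `f`. -/
theorem CharDual.exists_factor (f : A →+ B) (χ : CharDual A) (h : f.ker ≤ χ.ker) :
    ∃ ψ : CharDual B, ψ.comp f = χ := by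
  obtain ⟨ψ, hψ⟩ := CharDual.exists_extension (QuotientAddGroup.kerLift f)
    (QuotientAddGroup.kerLift_injective f) (QuotientAddGroup.lift f.ker χ h)
  refine ⟨ψ, ?_⟩
  ext a
  exact DFunLike.congr_fun hψ (a : A ⧸ f.ker)

/-- Characters separate points from subgroups. -/
theorem CharDual.mem_of_forall (H : AddSubgroup A) (a : A)
    (h : ∀ χ : CharDual A, (∀ x ∈ H, χ x = 0) → χ a = 0) : a ∈ H := by
  rw [← QuotientAddGroup.eq_zero_iff]
  refine CharacterModule.eq_zero_of_character_apply fun c => ?_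
  refine h (AddMonoidHom.comp (show A ⧸ H →+ _ from c) (QuotientAddGroup.mk' H)) fun x hx => ?_
  have hx' : (QuotientAddGroup.mk' H) x = 0 := (QuotientAddGroup.eq_zero_iff x).2 hx
  rw [AddMonoidHom.comp_apply, hx', map_zero]

variable [Module R A] [Module R B] [Module R C]

/-- The right action on characters, `(χ • r) a = χ (r • a)`. -/
instance CharDual.instModule : Module Rᵐᵒᵖ (CharDual A) where
  smul r χ := χ.comp (DistribSMul.toAddMonoidHom A r.unop)
  one_smul χ := AddMonoidHom.ext fun a => congrArg χ (one_smul R a)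
  mul_smul r s χ := AddMonoidHom.ext fun a => congrArg χ (mul_smul s.unop r.unop a)
  smul_zero _ := rfl
  smul_add _ _ _ := rfl
  add_smul r s χ := AddMonoidHom.ext fun a =>
    (congrArg χ (add_smul r.unop s.unop a)).trans (map_add χ _ _)
  zero_smul χ := AddMonoidHom.ext fun a => (congrArg χ (zero_smul R a)).trans (map_zero χ)

theorem CharDual.smul_apply (r : Rᵐᵒᵖ) (χ : CharDual A) (a : A) :
    (r • χ) a = χ (r.unop • a) := rfl

/-- Precomposition with a linear map, as a map of right modules of characters. -/
def CharDual.map (f : A →ₗ[R] B) : CharDual B →ₗ[Rᵐᵒᵖ] CharDual A where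
  toFun χ := χ.comp f.toAddMonoidHom
  map_add' _ _ := rfl
  map_smul' r χ := by
    ext a
    simp [CharDual.smul_apply]

@[simp]
theorem CharDual.map_apply (f : A →ₗ[R] B) (χ : CharDual B) (a : A) :
    CharDual.map f χ a = χ (f a) := rfl

theorem CharDual.map_injective (f : A →ₗ[R] B) (hf : Function.Surjective f) :
    Function.Injective (CharDual.map f) := by
  intro χ ψ h
  ext b
  obtain ⟨a, rfl⟩ := hf b
  exact DFunLike.congr_fun h a

theorem CharDual.map_surjective (f : A →ₗ[R] B) (hf : Function.Injective f) :
    Function.Surjective (CharDual.map f) :=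
  CharDual.exists_extension f.toAddMonoidHom hf

theorem CharDual.map_exact (f : A →ₗ[R] B) (g : B →ₗ[R] C) (h : Function.Exact f g) :
    Function.Exact (CharDual.map g) (CharDual.map f) := by
  intro χ
  constructor
  · intro hχ
    refine CharDual.exists_factor g.toAddMonoidHom χ fun b hb => ?_
    obtain ⟨a, rfl⟩ := (h b).1 hb
    exact DFunLike.congr_fun hχ a
  · rintro ⟨ψ, rfl⟩
    ext a
    simp [h.apply_apply_eq_zero]

/-- The character module of a finite free module is injective. -/
theorem CharDual.injective_pi (n : ℕ) : Module.Injective Rᵐᵒᵖ (CharDual (Fin n → R)) where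
  out X Y _ _ _ _ i hi g := by
    have hg (j : Fin n) := CharDual.exists_extension i.toAddMonoidHom hi
      ((AddMonoidHom.eval (Pi.single j (1 : R))).comp g.toAddMonoidHom)
    choose χ hχ using hg
    let g' : Y →ₗ[Rᵐᵒᵖ] CharDual (Fin n → R) :=
      { toFun := fun y =>
          { toFun := fun p => ∑ j, χ j (MulOpposite.op (p j) • y)
            map_zero' := by
              refine Finset.sum_eq_zero fun j _ => ?_
              have : MulOpposite.op ((0 : Fin n → R) j) = 0 := rfl
              rw [this, zero_smul, map_zero]
            map_add' := fun p q => by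
              rw [← Finset.sum_add_distrib]
              refine Finset.sum_congr rfl fun j _ => ?_
              have : MulOpposite.op ((p + q) j) = MulOpposite.op (p j) + MulOpposite.op (q j) := rfl
              rw [this, add_smul, map_add] }
        map_add' := fun y z => by
          refine AddMonoidHom.ext fun p => ?_
          simp [smul_add, Finset.sum_add_distrib]
        map_smul' := fun r y => by
          refine AddMonoidHom.ext fun p => ?_
          simp only [AddMonoidHom.coe_mk, ZeroHom.coe_mk, RingHom.id_apply,
            CharDual.smul_apply, smul_smul, Pi.smul_apply, smul_eq_mul,
            MulOpposite.op_mul, MulOpposite.op_unop] }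
    refine ⟨g', fun x => ?_⟩
    refine AddMonoidHom.ext fun p => ?_
    have key (j : Fin n) : χ j (MulOpposite.op (p j) • i x) = g x (Pi.single j (p j)) := by
      rw [← map_smul]
      have := DFunLike.congr_fun (hχ j) (MulOpposite.op (p j) • x)
      refine this.trans ?_
      change g (MulOpposite.op (p j) • x) (Pi.single j 1) = _
      rw [map_smul, CharDual.smul_apply, MulOpposite.unop_op, ← Pi.single_smul,
        smul_eq_mul, mul_one]
    change ∑ j, χ j (MulOpposite.op (p j) • i x) = _
    rw [Finset.sum_congr rfl fun j _ => key j, ← map_sum, Finset.univ_sum_single]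

/-- Over a left noetherian ring, a finitely generated module with injective character module is
projective. -/
theorem CharDual.projective_of_injective [IsNoetherianRing R] [Module.Finite R A]
    (h : Module.Injective Rᵐᵒᵖ (CharDual A)) : Module.Projective R A := by
  obtain ⟨b, π, hπ⟩ := Module.Finite.exists_fin' R A
  obtain ⟨r, hr⟩ := h.out (CharDual.map π) (CharDual.map_injective π hπ) LinearMap.id
  obtain ⟨m, a, ha⟩ := Submodule.fg_iff_exists_fin_generating_family.1
    (IsNoetherian.noetherian (LinearMap.ker π))
  let x : Fin b → A := fun j => π (Pi.single j 1)
  have hx (p : Fin b → R) : ∑ j, p j • x j = π p := by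
    conv_rhs => rw [← Finset.univ_sum_single p, map_sum]
    refine Finset.sum_congr rfl fun j _ => ?_
    rw [← map_smul, ← Pi.single_smul, smul_eq_mul, mul_one]
  let rel : (Fin b → (Fin b → R)) →+ (Fin m → (Fin b → R)) :=
    { toFun := fun y i => ∑ j, a i j • y j
      map_zero' := by ext; simp
      map_add' := fun y z => by ext; simp [Finset.sum_add_distrib] }
  let πb : (Fin b → (Fin b → R)) →+ (Fin b → A) := π.toAddMonoidHom.compLeft (Fin b)
  have hmem : x ∈ rel.ker.map πb := by
    refine CharDual.mem_of_forall _ _ fun φ hφ => ?_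
    obtain ⟨ψ, hψ⟩ := CharDual.exists_factor rel (φ.comp πb)
      fun y hy => hφ _ (AddSubgroup.mem_map_of_mem _ hy)
    let φ' (j : Fin b) : CharDual A := φ.comp (AddMonoidHom.single (fun _ => A) j)
    let ψ' (i : Fin m) : CharDual (Fin b → R) :=
      ψ.comp (AddMonoidHom.single (fun _ => Fin b → R) i)
    have h1 (j : Fin b) : CharDual.map π (φ' j) = ∑ i, MulOpposite.op (a i j) • ψ' i := by
      refine AddMonoidHom.ext fun p => ?_
      have := DFunLike.congr_fun hψ (Pi.single j p)
      have e1 : πb (Pi.single j p) = Pi.single j (π p) := by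
        ext l
        by_cases hl : l = j
        · subst hl; simp [πb]
        · simp [πb, hl]
      have e2 : rel (Pi.single j p) = ∑ i, Pi.single i (a i j • p) := by
        rw [Finset.univ_sum_single]
        ext i : 1
        change ∑ l, a i l • (Pi.single j p : Fin b → (Fin b → R)) l = _
        rw [Finset.sum_eq_single j]
        · simp
        · intro l _ hl; simp [hl]
        · simp
      rw [AddMonoidHom.comp_apply, AddMonoidHom.comp_apply, e1, e2, map_sum] at this
      rw [CharDual.map_apply, AddMonoidHom.finsetSum_apply]
      exact this.symm
    have h2 (j : Fin b) : φ' j = ∑ i, MulOpposite.op (a i j) • r (ψ' i) := by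
      have := hr (φ' j)
      rw [h1, map_sum] at this
      simpa using this.symm
    have h3 : φ x = ∑ j, φ' j (x j) := by
      conv_lhs => rw [← Finset.univ_sum_single x, map_sum]
      rfl
    rw [h3]
    simp_rw [h2, AddMonoidHom.finsetSum_apply, CharDual.smul_apply,
      MulOpposite.unop_op]
    rw [Finset.sum_comm]
    refine Finset.sum_eq_zero fun i _ => ?_
    rw [← map_sum, hx]
    have : a i ∈ LinearMap.ker π := ha ▸ Submodule.subset_span ⟨i, rfl⟩
    rw [LinearMap.mem_ker.1 this, map_zero]
  obtain ⟨y, hy, hyx⟩ := hmem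
  let s : (Fin b → R) →ₗ[R] (Fin b → R) := Fintype.linearCombination R y
  have hs : LinearMap.ker π ≤ LinearMap.ker s := by
    rw [← ha, Submodule.span_le]
    rintro _ ⟨i, rfl⟩
    exact congrFun hy i
  let e := π.quotKerEquivOfSurjective hπ
  refine Module.Projective.of_split ((LinearMap.ker π).liftQ s hs ∘ₗ e.symm.toLinearMap) π ?_
  ext z
  obtain ⟨p, rfl⟩ := hπ z
  have he : e.symm (π p) = (LinearMap.ker π).mkQ p := by
    rw [LinearEquiv.symm_apply_eq]; rfl
  have hyx' (j : Fin b) : π (y j) = x j := congrFun hyx j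
  simp only [LinearMap.comp_apply, LinearEquiv.coe_coe, he, Submodule.mkQ_apply,
    Submodule.liftQ_apply, LinearMap.id_apply]
  simp only [s, Fintype.linearCombination_apply, map_sum, map_smul, hyx', hx]

end CharacterDual

section ExtVanishing

variable {R : Type u} [Ring R]

/-- A module is injective if `Ext¹(R/I, X) = 0` for all left ideals `I`. -/
theorem injective_of_ext_one_quotient (X : ModuleCat.{u} R)
    (h : ∀ I : Ideal R, Subsingleton (Abelian.Ext (ModuleCat.of R (R ⧸ I)) X 1)) :
    Module.Injective R X := by
  refine Module.Baer.injective fun I g => ?_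
  let S : ShortComplex (ModuleCat.{u} R) :=
    ModuleCat.shortComplexOfCompEqZero I.subtype I.mkQ
      (LinearMap.exact_subtype_mkQ I).linearMap_comp_eq_zero
  have hS : S.ShortExact := ModuleCat.shortComplex_shortExact S (LinearMap.exact_subtype_mkQ I)
    I.injective_subtype I.mkQ_surjective
  obtain ⟨x, hx⟩ := Abelian.Ext.contravariant_sequence_exact₁ hS X
    (Abelian.Ext.mk₀ (show S.X₁ ⟶ X from ModuleCat.ofHom g)) (add_zero 1)
    ((h I).elim _ _)
  obtain ⟨f, rfl⟩ := Abelian.Ext.mk₀_bijective _ _ |>.surjective x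
  rw [Abelian.Ext.mk₀_comp_mk₀] at hx
  have hf := (Abelian.Ext.mk₀_bijective _ _).injective hx
  exact ⟨f.hom, fun r hr => ConcreteCategory.congr_hom hf (⟨r, hr⟩ : I)⟩

/-- Dimension shifting along a short exact sequence with injective middle term. -/
theorem subsingleton_ext_of_injective {S : ShortComplex (ModuleCat.{u} R)} (hS : S.ShortExact)
    [Injective S.X₂] (Y : ModuleCat.{u} R) (n : ℕ)
    (h : Subsingleton (Abelian.Ext Y S.X₁ (n + 2))) :
    Subsingleton (Abelian.Ext Y S.X₃ (n + 1)) := by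
  refine subsingleton_of_forall_eq 0 fun x => ?_
  obtain ⟨y, rfl⟩ := Abelian.Ext.covariant_sequence_exact₃ Y hS x rfl (h.elim _ _)
  rw [Abelian.Ext.eq_zero_of_injective y, Abelian.Ext.zero_comp]

/-- If `Ext` of the cyclic right modules into the character module of `N` vanishes in degree
`n + 1`, then `N` has projective dimension at most `n`. -/
theorem pdLE_of_ext_charDual [IsNoetherianRing R] (n : ℕ) (N : ModuleCat.{u} R)
    (hN : Module.Finite R N)
    (h : ∀ I : Ideal Rᵐᵒᵖ, Subsingleton
      (Abelian.Ext (ModuleCat.of Rᵐᵒᵖ (Rᵐᵒᵖ ⧸ I)) (ModuleCat.of Rᵐᵒᵖ (CharDual N)) (n + 1))) :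
    pdLE R n N := by
  induction n generalizing N with
  | zero =>
    have := CharDual.projective_of_injective
      (injective_of_ext_one_quotient (ModuleCat.of Rᵐᵒᵖ (CharDual N)) h)
    exact (IsProjective.iff_projective _).1 this
  | succ n ih =>
    obtain ⟨b, π, hπ⟩ := Module.Finite.exists_fin' R N
    have hex : Function.Exact (LinearMap.ker π).subtype π := LinearMap.exact_subtype_ker_map π
    refine ⟨ModuleCat.of R (Fin b → R), ModuleCat.of R (LinearMap.ker π),
      ModuleCat.ofHom (LinearMap.ker π).subtype, ModuleCat.ofHom π,
      (IsProjective.iff_projective _).1 inferInstance,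
      (LinearMap.ker π).injective_subtype, hπ, hex, ?_⟩
    refine ih _ (show Module.Finite R (LinearMap.ker π) from inferInstance) fun I => ?_
    have hex' := CharDual.map_exact _ _ hex
    let S : ShortComplex (ModuleCat.{u} Rᵐᵒᵖ) := ModuleCat.shortComplexOfCompEqZero
      (CharDual.map π) (CharDual.map (LinearMap.ker π).subtype) hex'.linearMap_comp_eq_zero
    have hS : S.ShortExact := ModuleCat.shortComplex_shortExact S hex'
      (CharDual.map_injective π hπ)
      (CharDual.map_surjective _ (LinearMap.ker π).injective_subtype)
    have : Module.Injective Rᵐᵒᵖ (CharDual (Fin b → R)) := CharDual.injective_pi b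
    have : Injective S.X₂ := Module.injective_object_of_injective_module _ (CharDual (Fin b → R))
    exact subsingleton_ext_of_injective hS _ n (h I)

/-- If all cyclic right modules have projective dimension at most `n`, then the left noetherian
ring `R` has left global dimension at most `n`. -/
theorem gldimLE_of_hasProjectiveDimensionLE_quotient [IsNoetherianRing R] (n : ℕ)
    (h : ∀ I : Ideal Rᵐᵒᵖ, HasProjectiveDimensionLE (ModuleCat.of Rᵐᵒᵖ (Rᵐᵒᵖ ⧸ I)) n) :
    gldimLE R n := fun N hN =>
  pdLE_of_ext_charDual n N hN fun I =>
    have := h I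
    HasProjectiveDimensionLT.subsingleton _ (n + 1) _ le_rfl _

/-- A module with a finite exact resolution `0 → C n → ⋯ → C 1 → C 0 → 0` by projectives has
projective dimension less than `n`. -/
theorem hasProjectiveDimensionLT_of_resolution (n : ℕ) (hn : 1 ≤ n) (C : ℕ → ModuleCat.{u} R)
    (d : ∀ i, C (i + 1) ⟶ C i) (hC : ∀ i, 1 ≤ i → i ≤ n → Projective (C i))
    (hsurj : Function.Surjective (d 0)) (hinj : Function.Injective (d (n - 1)))
    (hex : ∀ i, i + 2 ≤ n → Function.Exact (d (i + 1)) (d i)) :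
    HasProjectiveDimensionLT (C 0) n := by
  have key (j : ℕ) (hj : j < n) : HasProjectiveDimensionLT
      (ModuleCat.of R (LinearMap.range (d (n - 1 - j)).hom)) (j + 1) := by
    induction j with
    | zero =>
      have := hC (n - 1 + 1) (by lia) (by lia)
      exact hasProjectiveDimensionLT_of_iso
        (LinearEquiv.ofInjective (d (n - 1)).hom hinj).toModuleIso 1
    | succ j ih =>
      obtain ⟨i, hi, hi'⟩ : ∃ i, n - 1 - j = i + 1 ∧ n - 1 - (j + 1) = i := ⟨_, by lia, rfl⟩
      have ih := ih (by lia)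
      rw [hi] at ih
      rw [hi']
      have hexi := hex i (by lia)
      have hex' : Function.Exact (LinearMap.range (d (i + 1)).hom).subtype
          (d i).hom.rangeRestrict := by
        intro x
        rw [← LinearMap.mem_ker, LinearMap.ker_rangeRestrict, LinearMap.mem_ker]
        exact (hexi x).trans (by simp)
      let S : ShortComplex (ModuleCat.{u} R) := ModuleCat.shortComplexOfCompEqZero _ _
        hex'.linearMap_comp_eq_zero
      have hS : S.ShortExact := ModuleCat.shortComplex_shortExact S hex'
        (Submodule.injective_subtype _) (LinearMap.surjective_rangeRestrict _)
      have : Projective S.X₂ := hC (i + 1) (by lia) (by lia)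
      exact hS.hasProjectiveDimensionLT_X₃ (j + 1) ih inferInstance
  have h := key (n - 1) (by lia)
  rw [Nat.sub_self, Nat.sub_add_cancel hn] at h
  exact hasProjectiveDimensionLT_of_iso
    (LinearEquiv.ofTop _ (LinearMap.range_eq_top.2 hsurj)).toModuleIso n

end ExtVanishing

section HomRight

variable (Λ : Type u) [Ring Λ] (M : Type u) [AddCommGroup M] [Module Λ M]

/-- `Hom_Λ(M, X)`, regarded as a right module over `End_Λ(M)`. -/
def HomRight (X : Type u) [AddCommGroup X] [Module Λ X] : Type u := M →ₗ[Λ] X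

variable {X Y : Type u} [AddCommGroup X] [Module Λ X] [AddCommGroup Y] [Module Λ Y]

instance : AddCommGroup (HomRight Λ M X) := inferInstanceAs (AddCommGroup (M →ₗ[Λ] X))

instance : Module (Module.End Λ M)ᵐᵒᵖ (HomRight Λ M X) where
  smul e f := LinearMap.comp f e.unop
  one_smul _ := rfl
  mul_smul _ _ _ := rfl
  smul_zero _ := rfl
  smul_add _ _ _ := rfl
  add_smul a b f := LinearMap.comp_add (a.unop : M →ₗ[Λ] M) b.unop (f : M →ₗ[Λ] X)
  zero_smul f := LinearMap.comp_zero (M₂ := M) (f : M →ₗ[Λ] X)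

variable {Λ}

/-- Postcomposition as a map of right `End_Λ(M)`-modules. -/
def HomRight.map (f : X →ₗ[Λ] Y) :
    HomRight Λ M X →ₗ[(Module.End Λ M)ᵐᵒᵖ] HomRight Λ M Y where
  toFun g := LinearMap.comp f g
  map_add' g h := LinearMap.comp_add (g : M →ₗ[Λ] X) h f
  map_smul' _ _ := rfl

/-- `Hom_Λ(M, M)` is the regular right module of `End_Λ(M)`. -/
def HomRight.selfEquiv :
    HomRight Λ M M ≃ₗ[(Module.End Λ M)ᵐᵒᵖ] (Module.End Λ M)ᵐᵒᵖ where
  toFun f := MulOpposite.op f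
  invFun e := e.unop
  map_add' _ _ := rfl
  map_smul' _ _ := rfl

variable {M}

theorem HomRight.map_injective (f : X →ₗ[Λ] Y) (hf : Function.Injective f) :
    Function.Injective (HomRight.map M f) := fun _ _ h =>
  LinearMap.ext fun m => hf (LinearMap.congr_fun h m)

theorem HomRight.exact_map_subtype_ker (f : X →ₗ[Λ] Y) :
    Function.Exact (HomRight.map M (LinearMap.ker f).subtype) (HomRight.map M f) := by
  intro g
  constructor
  · intro h
    exact ⟨LinearMap.codRestrict (LinearMap.ker f) g fun m => LinearMap.congr_fun h m, rfl⟩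
  · rintro ⟨(g : M →ₗ[Λ] LinearMap.ker f), rfl⟩
    exact LinearMap.ext fun m => (g m).2

theorem HomRight.projective_of_retract (k : ℕ) (s : X →ₗ[Λ] (Fin k → M))
    (r : (Fin k → M) →ₗ[Λ] X) (h : r ∘ₗ s = LinearMap.id) :
    Module.Projective (Module.End Λ M)ᵐᵒᵖ (HomRight Λ M X) := by
  let i : HomRight Λ M X →ₗ[(Module.End Λ M)ᵐᵒᵖ] (Fin k → (Module.End Λ M)ᵐᵒᵖ) :=
    LinearMap.pi fun j => (HomRight.selfEquiv M).toLinearMap ∘ₗ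
      HomRight.map M (LinearMap.proj j ∘ₗ s)
  let p : (Fin k → (Module.End Λ M)ᵐᵒᵖ) →ₗ[(Module.End Λ M)ᵐᵒᵖ] HomRight Λ M X :=
    { toFun := fun e => r ∘ₗ LinearMap.pi fun j => (e j).unop
      map_add' := fun a b => LinearMap.ext fun m => map_add r (fun j => (a j).unop m) _
      map_smul' := fun _ _ => rfl }
  refine Module.Projective.of_split i p (LinearMap.ext fun (f : M →ₗ[Λ] X) => ?_)
  exact LinearMap.ext fun m => LinearMap.congr_fun h (f m)

/-- A finitely generated right ideal of `End_Λ(M)` is the image of `Hom_Λ(M, f)` for some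
`f : M^a → M`. -/
theorem HomRight.exists_range_eq (I : Ideal (Module.End Λ M)ᵐᵒᵖ) (hI : I.FG) :
    ∃ (a : ℕ) (f : (Fin a → M) →ₗ[Λ] M),
      LinearMap.range ((HomRight.selfEquiv M).toLinearMap ∘ₗ HomRight.map M f) = I := by
  obtain ⟨a, g, rfl⟩ := Submodule.fg_iff_exists_fin_generating_family.1 hI
  refine ⟨a, ∑ i, (g i).unop ∘ₗ LinearMap.proj i, le_antisymm ?_ ?_⟩
  · rintro _ ⟨h, rfl⟩
    have key : ((HomRight.selfEquiv M).toLinearMap ∘ₗ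
        HomRight.map M (∑ i, (g i).unop ∘ₗ LinearMap.proj i)) h =
        ∑ i, HomRight.selfEquiv M (HomRight.map M (LinearMap.proj i) h) • g i := by
      apply MulOpposite.unop_injective
      rw [Finset.unop_sum]
      refine LinearMap.ext fun m => ?_
      rw [LinearMap.sum_apply]
      exact LinearMap.sum_apply _ _ _
    rw [key]
    exact Submodule.sum_mem _ fun i _ =>
      Submodule.smul_mem _ _ (Submodule.subset_span ⟨i, rfl⟩)
  · rw [Submodule.span_le]
    rintro _ ⟨i, rfl⟩
    refine ⟨LinearMap.single Λ (fun _ => M) i, ?_⟩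
    apply MulOpposite.unop_injective
    refine LinearMap.ext fun m => ?_
    change (∑ j, (g j).unop ∘ₗ LinearMap.proj j) (Pi.single i m) = _
    rw [LinearMap.sum_apply, Finset.sum_eq_single i]
    · simp
    · intro j _ hj
      simp [hj]
    · simp

/-- If all `Hom_Λ(M, K)` with `K` a kernel of a map `M^a → M` have projective dimension less than
`n`, then the cyclic right modules over `End_Λ(M)` have projective dimension at most `n + 1`. -/
theorem HomRight.hasProjectiveDimensionLE_quotient [IsNoetherianRing (Module.End Λ M)ᵐᵒᵖ] (n : ℕ)
    (h : ∀ (a : ℕ) (f : (Fin a → M) →ₗ[Λ] M), HasProjectiveDimensionLT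
      (ModuleCat.of (Module.End Λ M)ᵐᵒᵖ (HomRight Λ M (LinearMap.ker f))) n)
    (I : Ideal (Module.End Λ M)ᵐᵒᵖ) :
    HasProjectiveDimensionLE (ModuleCat.of (Module.End Λ M)ᵐᵒᵖ ((Module.End Λ M)ᵐᵒᵖ ⧸ I))
      (n + 1) := by
  obtain ⟨a, f, rfl⟩ := HomRight.exists_range_eq I (IsNoetherian.noetherian I)
  set φ := (HomRight.selfEquiv M).toLinearMap ∘ₗ HomRight.map M f with hφ
  have hex : Function.Exact (HomRight.map M (LinearMap.ker f).subtype) φ.rangeRestrict := by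
    intro g
    rw [← LinearMap.mem_ker, LinearMap.ker_rangeRestrict, LinearMap.mem_ker]
    refine Iff.trans ?_ (HomRight.exact_map_subtype_ker f g)
    simp [hφ]
  let S : ShortComplex (ModuleCat.{u} (Module.End Λ M)ᵐᵒᵖ) :=
    ModuleCat.shortComplexOfCompEqZero _ _ hex.linearMap_comp_eq_zero
  have hS : S.ShortExact := ModuleCat.shortComplex_shortExact S hex
    (HomRight.map_injective _ (Submodule.injective_subtype _))
    (LinearMap.surjective_rangeRestrict _)
  have hP : Module.Projective (Module.End Λ M)ᵐᵒᵖ (HomRight Λ M (Fin a → M)) :=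
    HomRight.projective_of_retract a LinearMap.id LinearMap.id rfl
  have : Projective S.X₂ := (IsProjective.iff_projective _).1 hP
  have hI : HasProjectiveDimensionLT S.X₃ (n + 1) :=
    hS.hasProjectiveDimensionLT_X₃ n (h a f)
      (hasProjectiveDimensionLT_of_ge _ 1 (n + 1) (by lia))
  let T : ShortComplex (ModuleCat.{u} (Module.End Λ M)ᵐᵒᵖ) :=
    ModuleCat.shortComplexOfCompEqZero (LinearMap.range φ).subtype (LinearMap.range φ).mkQ
      (LinearMap.exact_subtype_mkQ _).linearMap_comp_eq_zero
  have hT : T.ShortExact := ModuleCat.shortComplex_shortExact T (LinearMap.exact_subtype_mkQ _)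
    (Submodule.injective_subtype _) (Submodule.mkQ_surjective _)
  have : Projective T.X₂ :=
    (IsProjective.iff_projective _).1 (inferInstanceAs
      (Module.Projective (Module.End Λ M)ᵐᵒᵖ (Module.End Λ M)ᵐᵒᵖ))
  exact hT.hasProjectiveDimensionLT_X₃ (n + 1) hI
    (hasProjectiveDimensionLT_of_ge _ 1 (n + 1 + 1) (by lia))

end HomRight

/-- The endomorphism ring of a finitely generated module over a finite algebra over a commutative
noetherian ring is noetherian on both sides. -/
theorem isNoetherianRing_end (k : Type u) {Λ : Type u} [CommRing k] [IsNoetherianRing k] [Ring Λ]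
    [Algebra k Λ] [Module.Finite k Λ] (M : Type u) [AddCommGroup M] [Module Λ M]
    [Module.Finite Λ M] :
    IsNoetherianRing (Module.End Λ M) ∧ IsNoetherianRing (Module.End Λ M)ᵐᵒᵖ := by
  let : Module k M := Module.compHom M (algebraMap k Λ)
  have : IsScalarTower k Λ M := IsScalarTower.of_algebraMap_smul fun _ _ => rfl
  have : Module.Finite k M := Module.Finite.trans Λ M
  have : IsNoetherian k (Module.End Λ M) :=
    isNoetherian_of_injective (LinearMap.restrictScalarsₗ k Λ M M k)
      (LinearMap.restrictScalars_injective k)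
  have : Module.Finite k (Module.End Λ M)ᵐᵒᵖ :=
    Module.Finite.equiv (MulOpposite.opLinearEquiv k : Module.End Λ M ≃ₗ[k] _)
  exact ⟨IsNoetherianRing.of_finite k _, IsNoetherianRing.of_finite k _⟩

/-- If `M` is a generator-cogenerator of `mod Λ` over a non-semisimple Artin algebra `Λ` and every
finitely generated module `X` admits an `add M`-resolution `0 → M_n → ⋯ → M_1 → X → 0` which stays
exact under `Hom(L, −)` for every `L ∈ add M`, then `gl.dim End(M) ≤ n + 1`. -/
theorem gldim_end_le_of_add_resolutions
    (k : Type u) (Λ : Type u) [CommRing k] [IsArtinianRing k] [Ring Λ] [Algebra k Λ]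
    [Module.Finite k Λ] (hns : ¬ IsSemisimpleRing Λ)
    (n : ℕ) (hn : 1 ≤ n) (M : ModuleCat.{u} Λ) (hMfin : Module.Finite Λ M)
    (hM : IsGenCogen Λ M)
    (hres : ∀ X : ModuleCat.{u} Λ, Module.Finite Λ X →
      ∃ (C : ℕ → ModuleCat.{u} Λ) (d : ∀ i : ℕ, C (i+1) ⟶ C i),
        Nonempty (C 0 ≅ X) ∧
        (∀ i : ℕ, 1 ≤ i → i ≤ n → InAdd Λ M (C i)) ∧
        Function.Surjective (d 0) ∧
        Function.Injective (d (n-1)) ∧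
        (∀ i : ℕ, i + 2 ≤ n → Function.Exact (d (i+1)) (d i)) ∧
        (∀ L : ModuleCat.{u} Λ, InAdd Λ M L →
          (Function.Surjective (fun g : L ⟶ C 1 => g ≫ d 0) ∧
           ∀ i : ℕ, i + 2 ≤ n →
             Function.Exact (fun g : L ⟶ C (i+2) => g ≫ d (i+1))
               (fun g : L ⟶ C (i+1) => g ≫ d i)))) :
    gldimLE (Module.End Λ M) (n + 1) := by
  have : IsNoetherianRing Λ := IsNoetherianRing.of_finite k Λ
  obtain ⟨hleft, hright⟩ := isNoetherianRing_end k (Λ := Λ) M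
  refine gldimLE_of_hasProjectiveDimensionLE_quotient (n + 1)
    (HomRight.hasProjectiveDimensionLE_quotient n fun a f => ?_)
  obtain ⟨C, d, ⟨e⟩, hadd, -, hinj, -, hL⟩ := hres (ModuleCat.of Λ (LinearMap.ker f))
    (show Module.Finite Λ (LinearMap.ker f) from inferInstance)
  obtain ⟨hsurj, hex⟩ := hL M ⟨1, ModuleCat.ofHom (LinearMap.pi fun _ => LinearMap.id),
    ModuleCat.ofHom (LinearMap.proj 0), rfl⟩
  have hres' := hasProjectiveDimensionLT_of_resolution n hn
    (fun i => ModuleCat.of (Module.End Λ M)ᵐᵒᵖ (HomRight Λ M (C i)))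
    (fun i => ModuleCat.ofHom (HomRight.map M (d i).hom)) ?_ ?_
    (HomRight.map_injective _ hinj) ?_
  · let e' : HomRight Λ M (C 0) ≃ₗ[(Module.End Λ M)ᵐᵒᵖ] HomRight Λ M (LinearMap.ker f) :=
      LinearEquiv.ofLinearMap (HomRight.map M e.hom.hom) (HomRight.map M e.inv.hom)
        (LinearMap.ext fun (g : M →ₗ[Λ] LinearMap.ker f) => LinearMap.ext fun m =>
          ConcreteCategory.congr_hom e.inv_hom_id (g m))
        (LinearMap.ext fun (g : M →ₗ[Λ] C 0) => LinearMap.ext fun m =>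
          ConcreteCategory.congr_hom e.hom_inv_id (g m))
    exact hasProjectiveDimensionLT_of_iso e'.toModuleIso n
  · intro i hi hin
    obtain ⟨m, s, r, hsr⟩ := hadd i hi hin
    exact (IsProjective.iff_projective _).1
      (HomRight.projective_of_retract m s.hom r.hom (congrArg ModuleCat.Hom.hom hsr))
  · intro g
    obtain ⟨g', hg'⟩ := hsurj (ModuleCat.ofHom g)
    exact ⟨g'.hom, congrArg ModuleCat.Hom.hom hg'⟩
  · intro i hi g
    have hg := hex i hi (ModuleCat.ofHom g)
    constructor
    · intro h
      obtain ⟨g', hg'⟩ := hg.1 (ModuleCat.hom_ext h)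
      exact ⟨g'.hom, congrArg ModuleCat.Hom.hom hg'⟩
    · rintro ⟨g', hg'⟩
      exact congrArg ModuleCat.Hom.hom (hg.2 ⟨ModuleCat.ofHom g', ModuleCat.hom_ext hg'⟩)
end

section
/- Let Λ be a non-semisimple Artin algebra. Then Λ is of finite representation type if and only if its representation dimension is at most 2 (Auslander). -/
open CategoryTheory
universe u

/-- `Λ` is of finite representation type: there is an additive generator, i.e. a finitely
generated module `M` such that every finitely generated module lies in `add M` (equivalently,
there are only finitely many isomorphism classes of indecomposables). -/
def FiniteRepType (R : Type u) [Ring R] : Prop :=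
  ∃ M : ModuleCat.{u} R, Module.Finite R M ∧
    ∀ N : ModuleCat.{u} R, Module.Finite R N → InAdd R M N

theorem isSemisimpleModule_torsionBySet_jacobson (R E : Type u) [CommRing R] [IsArtinianRing R]
    [AddCommGroup E] [Module R E] :
    IsSemisimpleModule R (Submodule.torsionBySet R E (Ring.jacobson R)) := by
  have h := Submodule.torsionBySet_isTorsionBySet (R := R) (M := E) (Ring.jacobson R : Set R)
  let _ := h.module
  exact (h.semilinearMap.isSemisimpleModule_iff_of_bijective Function.bijective_id).2 inferInstance

/-- An essential extension of a finitely generated module killed by the Jacobson radical is finitely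
generated, over a commutative Artinian ring. -/
theorem isNoetherian_of_essential {R E : Type u} [CommRing R] [IsArtinianRing R]
    [AddCommGroup E] [Module R E] (S : Submodule R E) [Module.Finite R S]
    (hS : S ≤ Submodule.torsionBySet R E (Ring.jacobson R))
    (ess : ∀ T : Submodule R E, Disjoint S T → T = ⊥) : IsNoetherian R E := by
  have hS' : S = Submodule.torsionBySet R E (Ring.jacobson R) := by
    have := isSemisimpleModule_torsionBySet_jacobson R E
    set A := Submodule.torsionBySet R E (Ring.jacobson R)
    obtain ⟨T, hT⟩ := exists_isCompl (S.comap A.subtype)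
    have h : T.map A.subtype = ⊥ := by
      apply ess
      rw [Submodule.disjoint_def]
      rintro _ hx ⟨y, hy, rfl⟩
      rw [(Submodule.disjoint_def.1 hT.disjoint) y hx hy, map_zero]
    have hT0 : T = ⊥ := by
      rw [eq_bot_iff]
      intro x hx
      have : A.subtype x ∈ T.map A.subtype := ⟨x, hx, rfl⟩
      rw [h] at this
      exact (Submodule.mem_bot R).2 (Subtype.ext ((Submodule.mem_bot R).1 this))
    have := hT.codisjoint.eq_top
    rw [hT0, sup_bot_eq] at this
    exact le_antisymm hS (Submodule.comap_subtype_eq_top.1 this)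
  have key : ∀ i : ℕ, IsNoetherian R
      (Submodule.torsionBySet R E ((Ring.jacobson R ^ i : Ideal R) : Set R)) := by
    intro i
    induction i with
    | zero =>
      have : Submodule.torsionBySet R E ((Ring.jacobson R ^ 0 : Ideal R) : Set R) = ⊥ := by
        rw [eq_bot_iff]
        intro x hx
        simpa using (Submodule.mem_torsionBySet_iff _ x).1 hx ⟨1, by simp⟩
      rw [this]
      infer_instance
    | succ i ih =>
      obtain ⟨s, hs⟩ := IsNoetherian.noetherian (Ring.jacobson R : Ideal R)
      set B := Submodule.torsionBySet R E ((Ring.jacobson R ^ i : Ideal R) : Set R)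
      set B' := Submodule.torsionBySet R E ((Ring.jacobson R ^ (i + 1) : Ideal R) : Set R)
      have hmem : ∀ a : s, ∀ x : B', a.1 • x.1 ∈ B := by
        intro a x
        rw [Submodule.mem_torsionBySet_iff]
        rintro ⟨b, hb⟩
        have ha : a.1 ∈ Ring.jacobson R := hs ▸ Submodule.subset_span a.2
        have := (Submodule.mem_torsionBySet_iff _ x.1).1 x.2
          ⟨b * a.1, by rw [pow_succ]; exact Ideal.mul_mem_mul hb ha⟩
        simpa [mul_smul] using this
      let f : B' →ₗ[R] (s → B) := LinearMap.pi fun a ↦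
        LinearMap.codRestrict B (a.1 • B'.subtype) (hmem a)
      have hker : IsNoetherian R (LinearMap.ker f) := by
        have hle : ∀ x : LinearMap.ker f, x.1.1 ∈ S := by
          intro x
          rw [hS', ← hs, ← Submodule.torsionBySet_eq_torsionBySet_span,
            Submodule.mem_torsionBySet_iff]
          intro a
          exact congrArg Subtype.val (congrFun (LinearMap.mem_ker.1 x.2) a)
        exact isNoetherian_of_injective
          (LinearMap.codRestrict S (B'.subtype ∘ₗ (LinearMap.ker f).subtype) hle)
          (fun x y h ↦ Subtype.ext (Subtype.ext (congrArg (Subtype.val : S → E) h)))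
      exact isNoetherian_of_range_eq_ker (LinearMap.ker f).subtype f (by simp)
  obtain ⟨n, hn⟩ := ((isSemiprimaryRing_iff R).1 inferInstance).2
  have := key n
  have htop : Submodule.torsionBySet R E ((Ring.jacobson R ^ n : Ideal R) : Set R) = ⊤ := by
    rw [hn, eq_top_iff]
    rintro x -
    rw [Submodule.mem_torsionBySet_iff]
    rintro ⟨b, hb⟩
    have : b = 0 := by simpa using hb
    simp [this]
  rw [htop] at this
  exact isNoetherian_top_iff.1 this

theorem exists_maximal_disjoint {R I : Type*} [Ring R] [AddCommGroup I] [Module R I]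
    (S : Submodule R I) : ∃ C, Maximal (fun C : Submodule R I ↦ Disjoint S C) C := by
  refine zorn_le₀ {C : Submodule R I | Disjoint S C} fun c hc hchain ↦ ?_
  refine ⟨sSup c, ?_, fun _ ↦ le_sSup⟩
  rcases c.eq_empty_or_nonempty with rfl | hne
  · simp
  · exact (DirectedOn.disjoint_sSup_right hchain.directedOn).2 fun b hb ↦ hc hb

/-- The quotient by a maximal submodule disjoint from `S` is an essential extension of `S`. -/
theorem essential_map_mkQ {R I : Type*} [Ring R] [AddCommGroup I] [Module R I]
    {S C : Submodule R I} (hC : Maximal (fun C : Submodule R I ↦ Disjoint S C) C)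
    (T : Submodule R (I ⧸ C)) (hT : Disjoint (S.map C.mkQ) T) : T = ⊥ := by
  have hle : C ≤ T.comap C.mkQ := fun x hx ↦ by simp [(Submodule.Quotient.mk_eq_zero C).2 hx]
  have hdis : Disjoint S (T.comap C.mkQ) := by
    rw [Submodule.disjoint_def]
    intro x hxS hxT
    have := Submodule.disjoint_def.1 hT (C.mkQ x) ⟨x, hxS, rfl⟩ hxT
    exact Submodule.disjoint_def.1 hC.prop x hxS ((Submodule.Quotient.mk_eq_zero C).1 this)
  have hle' := hC.le_of_ge hdis hle
  rw [eq_bot_iff]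
  intro y hy
  obtain ⟨x, rfl⟩ := C.mkQ_surjective y
  exact (Submodule.Quotient.mk_eq_zero C).2 (hle' hy)

/-- Every finitely generated module killed by the Jacobson radical of a commutative Artinian ring
embeds in a finitely generated injective module. -/
theorem exists_finite_injective_of_torsionBy_jacobson {R S : Type u} [CommRing R] [IsArtinianRing R]
    [AddCommGroup S] [Module R S] [Module.Finite R S]
    (hS : Module.IsTorsionBySet R S (Ring.jacobson R)) :
    ∃ (E : Type u) (_ : AddCommGroup E) (_ : Module R E) (j : S →ₗ[R] E),
      Module.Finite R E ∧ Module.Injective R E ∧ Function.Injective j := by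
  let I := Injective.under (ModuleCat.of R S)
  have hI : Module.Injective R I :=
    Module.injective_module_of_injective_object R I (inj := inferInstanceAs (Injective I))
  let ι : S →ₗ[R] I := (Injective.ι (ModuleCat.of R S)).hom
  have hι : Function.Injective ι := (ModuleCat.mono_iff_injective _).1 inferInstance
  obtain ⟨C, hC⟩ := exists_maximal_disjoint (LinearMap.range ι)
  let j : S →ₗ[R] I ⧸ C := C.mkQ ∘ₗ ι
  have hj : Function.Injective j := by
    rw [← LinearMap.ker_eq_bot, LinearMap.ker_eq_bot']
    intro x hx
    have hx' : ι x ∈ C := (Submodule.Quotient.mk_eq_zero C).1 hx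
    exact (map_eq_zero_iff ι hι).1 (Submodule.disjoint_def.1 hC.prop _ ⟨x, rfl⟩ hx')
  have ess : ∀ T : Submodule R (I ⧸ C), Disjoint (LinearMap.range j) T → T = ⊥ := fun T hT ↦
    essential_map_mkQ hC T (by rwa [← LinearMap.range_comp])
  have hnoeth : IsNoetherian R (I ⧸ C) := by
    refine isNoetherian_of_essential (LinearMap.range j) ?_ ess
    rintro _ ⟨x, rfl⟩
    rw [Submodule.mem_torsionBySet_iff]
    intro a
    rw [← map_smul, hS (x := x) (a := a), map_zero]
  have : IsArtinian R (I ⧸ C) := inferInstance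
  obtain ⟨g, hg⟩ := Module.Injective.extension_property R I S (I ⧸ C) j hj ι
  have hinj : Function.Injective (C.mkQ ∘ₗ g) := by
    rw [← LinearMap.ker_eq_bot]
    apply ess
    rw [Submodule.disjoint_def]
    rintro _ ⟨x, rfl⟩ hx
    have h1 : g (j x) = ι x := LinearMap.congr_fun hg x
    have h2 : C.mkQ (g (j x)) = 0 := hx
    rwa [h1] at h2
  let e := LinearEquiv.ofBijective _ (IsArtinian.bijective_of_injective_endomorphism _ hinj)
  refine ⟨I ⧸ C, inferInstance, inferInstance, j, inferInstance, ⟨?_⟩, hj⟩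
  intro X Y _ _ _ _ f hf φ
  obtain ⟨h, hh⟩ := Module.Injective.extension_property R I X Y f hf (g ∘ₗ e.symm.toLinearMap ∘ₗ φ)
  refine ⟨C.mkQ ∘ₗ h, fun x ↦ ?_⟩
  have h1 : h (f x) = g (e.symm (φ x)) := LinearMap.congr_fun hh x
  have h2 : C.mkQ (g (e.symm (φ x))) = φ x := e.apply_symm_apply (φ x)
  simpa [h1] using h2

/-- A commutative Artinian ring has a finitely generated injective cogenerator. -/
theorem exists_finite_injective_cogenerator_comm (R : Type u) [CommRing R] [IsArtinianRing R] :
    ∃ (E : Type u) (_ : AddCommGroup E) (_ : Module R E), Module.Finite R E ∧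
      Module.Injective R E ∧ ∀ (N : Type u) [AddCommGroup N] [Module R N] (y : N), y ≠ 0 →
        ∃ h : N →ₗ[R] E, h y ≠ 0 := by
  obtain ⟨E, _, _, j, hfin, hE, hj⟩ := exists_finite_injective_of_torsionBy_jacobson
    (R := R) (S := R ⧸ Ring.jacobson R) (by
      rw [Module.isTorsionBySet_quotient_iff]
      intro r a ha
      simpa using Ideal.mul_mem_right r _ ha)
  refine ⟨E, _, _, hfin, hE, fun N _ _ y hy ↦ ?_⟩
  have hne : Ideal.torsionOf R N y ≠ ⊤ := by
    rwa [Ne, Ideal.torsionOf_eq_top_iff]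
  obtain ⟨m, hm, hle⟩ := Ideal.exists_le_maximal _ hne
  have hJm : Ring.jacobson R ≤ m := by
    rw [Ring.jacobson_eq_sInf_isMaximal]
    exact sInf_le hm
  -- a section of the projection of `R ⧸ J` onto the simple module `R ⧸ m`
  let π : (R ⧸ Ring.jacobson R) →ₗ[R] R ⧸ m := Submodule.factor hJm
  have hπ : Function.Surjective π := Submodule.factor_surjective hJm
  have : IsSemisimpleModule R (R ⧸ Ring.jacobson R) := by
    have := (isSemiprimaryRing_iff R).1 inferInstance
    have := this.1
    let q : R ⧸ Ring.jacobson R →ₛₗ[Ideal.Quotient.mk (Ring.jacobson R)] R ⧸ Ring.jacobson R :=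
      ⟨.id _, fun _ _ ↦ rfl⟩
    exact (q.isSemisimpleModule_iff_of_bijective Function.bijective_id).2 inferInstance
  obtain ⟨σ, hσ⟩ := IsSemisimpleModule.lifting_property π hπ LinearMap.id
  have hσinj : Function.Injective σ := fun a b hab ↦ by
    simpa [← LinearMap.comp_apply, hσ] using congrArg π hab
  let τ : (R ∙ y) →ₗ[R] R ⧸ m :=
    (Submodule.factor hle) ∘ₗ (Ideal.quotTorsionOfEquivSpanSingleton R N y).symm.toLinearMap
  obtain ⟨h, hh⟩ := Module.Injective.extension_property R E (R ∙ y) N (R ∙ y).subtype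
    (R ∙ y).subtype_injective (j ∘ₗ σ ∘ₗ τ)
  refine ⟨h, fun h0 ↦ ?_⟩
  have h1 : j (σ (τ ⟨y, Submodule.mem_span_singleton_self y⟩)) = 0 := by
    rw [← h0]
    exact (LinearMap.congr_fun hh ⟨y, Submodule.mem_span_singleton_self y⟩).symm
  rw [map_eq_zero_iff j hj, map_eq_zero_iff σ hσinj] at h1
  have h2 : (Ideal.quotTorsionOfEquivSpanSingleton R N y).symm
      ⟨y, Submodule.mem_span_singleton_self y⟩ = Submodule.Quotient.mk 1 := by
    rw [LinearEquiv.symm_apply_eq, Ideal.quotTorsionOfEquivSpanSingleton_apply_mk, one_smul]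
  have h3 : (Submodule.Quotient.mk 1 : R ⧸ m) = 0 := by
    rw [← h1]
    simp [τ, h2]
  exact hm.ne_top ((Ideal.eq_top_iff_one m).2 ((Submodule.Quotient.mk_eq_zero m).1 h3))

/-- The coinduced module `Hom_k(Λ, E)`, an injective cogenerator when `E` is one. -/
theorem exists_finite_injective_cogenerator (k Λ : Type u) [CommRing k] [IsArtinianRing k] [Ring Λ]
    [Algebra k Λ] [Module.Finite k Λ] :
    ∃ Q : ModuleCat.{u} Λ, Module.Finite Λ Q ∧ Injective Q ∧
      ∀ (N : Type u) [AddCommGroup N] [Module Λ N] (y : N), y ≠ 0 →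
        ∃ h : N →ₗ[Λ] Q, h y ≠ 0 := by
  obtain ⟨E, _, _, hfin, hE, hcog⟩ := exists_finite_injective_cogenerator_comm k
  let φ := algebraMap k Λ
  let adj := ModuleCat.restrictCoextendScalarsAdj.{u} φ
  have hE' : Injective (ModuleCat.of k E) := Module.injective_object_of_injective_module k E
  have hcog' (N : ModuleCat.{u} k) (y : N) (hy : y ≠ 0) :
      ∃ h : N ⟶ ModuleCat.of k E, h.hom y ≠ 0 :=
    (hcog N y hy).imp' ModuleCat.ofHom fun _ h ↦ h
  let Q := (ModuleCat.coextendScalars φ).obj (ModuleCat.of k E)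
  refine ⟨Q, ?_, Injective.injective_of_adjoint adj _, fun N _ _ y hy ↦ ?_⟩
  · let _ : Module k Q := Module.compHom Q φ
    have : IsScalarTower k Λ Q := .of_algebraMap_smul fun _ _ ↦ rfl
    let e : Q →ₗ[k] (Λ →ₗ[k] E) :=
      { toFun := fun g ↦
          { toFun := fun x ↦ ModuleCat.CoextendScalars.equiv φ (ModuleCat.of k E) g x
            map_add' := fun x y ↦ map_add _ _ _
            map_smul' := fun c x ↦ by
              rw [Algebra.smul_def]
              exact LinearMap.map_smul (ModuleCat.CoextendScalars.equiv φ (ModuleCat.of k E) g) c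
                (show (ModuleCat.restrictScalars φ).obj (ModuleCat.of Λ Λ) from x) }
        map_add' := fun f g ↦ by
          ext x
          rfl
        map_smul' := fun c g ↦ by
          ext x
          change ModuleCat.CoextendScalars.equiv φ (ModuleCat.of k E) (φ c • g) x =
            c • ModuleCat.CoextendScalars.equiv φ (ModuleCat.of k E) g x
          rw [ModuleCat.CoextendScalars.smul_apply, ← Algebra.commutes]
          exact LinearMap.map_smul (ModuleCat.CoextendScalars.equiv φ (ModuleCat.of k E) g) c
                (show (ModuleCat.restrictScalars φ).obj (ModuleCat.of Λ Λ) from x) }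
    have he : Function.Injective e := fun f g hfg ↦ by
      apply (ModuleCat.CoextendScalars.equiv φ (ModuleCat.of k E)).injective
      exact LinearMap.ext fun x ↦ LinearMap.congr_fun hfg x
    have : IsNoetherian k Q := isNoetherian_of_injective e he
    exact .of_restrictScalars_finite k Λ Q
  · obtain ⟨f, hf⟩ := hcog' ((ModuleCat.restrictScalars φ).obj (ModuleCat.of Λ N)) y hy
    let g : ModuleCat.of Λ N ⟶ Q := adj.homEquiv (ModuleCat.of Λ N) (ModuleCat.of k E) f
    refine ⟨g.hom, fun h0 ↦ hf ?_⟩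
    have h1 : f = (ModuleCat.restrictScalars φ).map g ≫ adj.counit.app _ :=
      ((adj.homEquiv _ _).symm_apply_apply f).symm.trans (adj.homEquiv_counit _ _ _)
    rw [h1]
    exact (congrArg (adj.counit.app (ModuleCat.of k E)).hom h0).trans (map_zero _)

theorem InAdd.of_linearMap {R : Type u} [Ring R] {M : ModuleCat.{u} R} {N : ModuleCat.{u} R} {n : ℕ}
    (s : N →ₗ[R] (Fin n → M)) (r : (Fin n → M) →ₗ[R] N) (h : r ∘ₗ s = LinearMap.id) :
    InAdd R M N :=
  ⟨n, ModuleCat.ofHom s, ModuleCat.ofHom r, by ext x; exact LinearMap.congr_fun h x⟩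

theorem InAdd.exists_linearMap {R : Type u} [Ring R] {M : ModuleCat.{u} R} {N : ModuleCat.{u} R}
    (h : InAdd R M N) : ∃ (n : ℕ) (s : N →ₗ[R] (Fin n → M)) (r : (Fin n → M) →ₗ[R] N),
      r ∘ₗ s = LinearMap.id := by
  obtain ⟨n, s, r, h⟩ := h
  exact ⟨n, s.hom, r.hom, congrArg ModuleCat.Hom.hom h⟩

theorem LinearMap.apply_eq_sum_smul_single {R N ι : Type*} [Semiring R] [AddCommMonoid N] [Module R N]
    [Fintype ι] [DecidableEq ι] (f : (ι → R) →ₗ[R] N) (v : ι → R) :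
    f v = ∑ i, v i • f (Pi.single i 1) := by
  conv_lhs => rw [pi_eq_sum_univ' v]
  simp

/-- If `N` is a direct summand of `M ^ n` then `Hom(N, M)` is a projective `End(M)`-module. -/
theorem projective_hom_of_retract {R M N ι : Type*} [Ring R] [AddCommGroup M] [Module R M]
    [AddCommGroup N] [Module R N] [Finite ι] (s : N →ₗ[R] (ι → M)) (r : (ι → M) →ₗ[R] N)
    (h : r ∘ₗ s = LinearMap.id) : Module.Projective (Module.End R M) (N →ₗ[R] M) := by
  classical
  have := Fintype.ofFinite ι
  let e : (ι → Module.End R M) ≃ₗ[Module.End R M] ((ι → M) →ₗ[R] M) :=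
    LinearMap.lsum R (fun _ ↦ M) (Module.End R M)
  refine Module.Projective.of_split (M := ι → Module.End R M)
    (e.symm.toLinearMap ∘ₗ LinearMap.lcomp (Module.End R M) M r)
    (LinearMap.lcomp (Module.End R M) M s ∘ₗ e.toLinearMap) ?_
  ext f x
  have h1 : r (s x) = x := LinearMap.congr_fun h x
  simp [h1]

theorem pdLE.hasProjectiveDimensionLT {R : Type u} [Ring R] {n : ℕ} {N : ModuleCat.{u} R}
    (h : pdLE R n N) : HasProjectiveDimensionLT N (n + 1) := by
  induction n generalizing N with
  | zero =>
    have : Projective N := h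
    infer_instance
  | succ n ih =>
    obtain ⟨P, K, ι, π, hP, hι, hπ, hex, hK⟩ := h
    have hS : (ModuleCat.shortComplexOfCompEqZero ι.hom π.hom
        (LinearMap.ext fun x ↦ (hex _).2 ⟨x, rfl⟩)).ShortExact :=
      ModuleCat.shortComplex_shortExact _ hex hι hπ
    exact hS.hasProjectiveDimensionLT_X₃ (n + 1) (ih hK) (inferInstanceAs
      (HasProjectiveDimensionLT P (n + 2)))

/-- If the cokernel of `β : A → B` has projective dimension at most two, with `A` and `B`
projective, then the kernel of `β` is projective. -/
theorem projective_ker_of_pdLE_two {R A B : Type u} [Ring R] [AddCommGroup A] [Module R A]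
    [AddCommGroup B] [Module R B] [Module.Projective R A] [Module.Projective R B] (β : A →ₗ[R] B)
    (h : pdLE R 2 (ModuleCat.of R (B ⧸ LinearMap.range β))) :
    Module.Projective R (LinearMap.ker β) := by
  have hA : Projective (ModuleCat.of R A) := inferInstance
  have hB : Projective (ModuleCat.of R B) := inferInstance
  have h1 := LinearMap.shortExact_shortComplexKer (LinearMap.range β).mkQ_surjective
  have h2 := LinearMap.shortExact_shortComplexKer β.surjective_rangeRestrict
  have h3 : HasProjectiveDimensionLT
      (ModuleCat.of R (LinearMap.ker (LinearMap.range β).mkQ)) 2 :=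
    h1.hasProjectiveDimensionLT_X₁ 2 (inferInstanceAs (HasProjectiveDimensionLT
      (ModuleCat.of R B) 2)) h.hasProjectiveDimensionLT
  rw [Submodule.ker_mkQ] at h3
  have h4 : HasProjectiveDimensionLT (ModuleCat.of R (LinearMap.ker β.rangeRestrict)) 1 :=
    h2.hasProjectiveDimensionLT_X₁ 1 (inferInstanceAs (HasProjectiveDimensionLT
      (ModuleCat.of R A) 1)) h3
  rw [LinearMap.ker_rangeRestrict] at h4
  exact (IsProjective.iff_projective _).2 (projective_iff_hasProjectiveDimensionLT_one.2 h4)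

section Evaluation

variable {R M : Type*} [Ring R] [AddCommGroup M] [Module R M]

/-- The evaluation map from `X` to its double dual with respect to `M`. -/
def evalEnd (R M X : Type*) [Ring R] [AddCommGroup M] [Module R M] [AddCommGroup X] [Module R X] :
    X →ₗ[R] ((X →ₗ[R] M) →ₗ[Module.End R M] M) where
  toFun x :=
    { toFun := fun f ↦ f x
      map_add' := fun _ _ ↦ rfl
      map_smul' := fun _ _ ↦ rfl }
  map_add' x y := by ext f; exact map_add f x y
  map_smul' c x := by ext f; exact map_smul f c x

/-- An `End(M)`-linear form on `Hom(X, M)` is compatible with every map that factors through a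
finite power of `M`. -/
theorem apply_eq_apply_comp_pi {X ι : Type*} [AddCommGroup X] [Module R X] [Fintype ι]
    (φ : (X →ₗ[R] M) →ₗ[Module.End R M] M) (j : ι → X →ₗ[R] M) (g : (ι → M) →ₗ[R] M) :
    g (fun i ↦ φ (j i)) = φ (g ∘ₗ LinearMap.pi j) := by
  classical
  have hg (m : ι → M) : g m = ∑ i, g (Pi.single i (m i)) := by
    rw [← map_sum, Finset.univ_sum_single]
  have h : g ∘ₗ LinearMap.pi j =
      ∑ i, (g ∘ₗ LinearMap.single R (fun _ ↦ M) i : Module.End R M) • j i := by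
    ext x
    rw [LinearMap.comp_apply, hg, LinearMap.sum_apply]
    rfl
  rw [h, map_sum, hg]
  exact Finset.sum_congr rfl fun i _ ↦
    (φ.map_smul (g ∘ₗ LinearMap.single R (fun _ ↦ M) i : Module.End R M) (j i)).symm

/-- If `M` has an injective direct summand that is a cogenerator, then every Artinian module is
reflexive with respect to `M`. -/
theorem evalEnd_bijective {R M Q X : Type u} [Ring R] [AddCommGroup M] [Module R M]
    [AddCommGroup Q] [Module R Q] [AddCommGroup X] [Module R X] [Module.Injective R Q]
    [IsArtinian R X]
    (hQ : ∀ (N : Type u) [AddCommGroup N] [Module R N] (y : N), y ≠ 0 →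
      ∃ (h : N →ₗ[R] Q) (t : Q →ₗ[R] M), t (h y) ≠ 0) :
    Function.Bijective (evalEnd R M X) := by
  constructor
  · rw [← LinearMap.ker_eq_bot, LinearMap.ker_eq_bot']
    intro x hx
    by_contra hne
    obtain ⟨h, t, ht⟩ := hQ X x hne
    exact ht (LinearMap.congr_fun hx (t ∘ₗ h))
  · intro φ
    obtain ⟨s, hs⟩ := Finset.exists_inf_le (fun f : X →ₗ[R] M ↦ LinearMap.ker f)
    let ι : X →ₗ[R] (s → M) := LinearMap.pi fun f ↦ f.1
    have hι : Function.Injective ι := by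
      rw [← LinearMap.ker_eq_bot, LinearMap.ker_eq_bot']
      intro x hx
      by_contra hne
      obtain ⟨h, t, ht⟩ := hQ X x hne
      refine ht (hs (t ∘ₗ h) ?_)
      rw [Submodule.mem_finsetInf]
      exact fun f hf ↦ congrFun hx ⟨f, hf⟩
    let q : s → M := fun f ↦ φ f.1
    have hq (g : (s → M) →ₗ[R] M) : g q = φ (g ∘ₗ ι) := apply_eq_apply_comp_pi φ _ g
    have hmem : q ∈ LinearMap.range ι := by
      by_contra hne
      obtain ⟨h, t, ht⟩ := hQ _ ((LinearMap.range ι).mkQ q)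
        (fun h0 ↦ hne ((Submodule.Quotient.mk_eq_zero _).1 h0))
      have h1 := hq (t ∘ₗ h ∘ₗ (LinearMap.range ι).mkQ)
      have h2 : (t ∘ₗ h ∘ₗ (LinearMap.range ι).mkQ) ∘ₗ ι = 0 := by
        rw [LinearMap.comp_assoc, LinearMap.comp_assoc, LinearMap.range_mkQ_comp,
          LinearMap.comp_zero, LinearMap.comp_zero]
      rw [h2, map_zero] at h1
      exact ht h1
    obtain ⟨x, hx⟩ := hmem
    refine ⟨x, LinearMap.ext fun f ↦ ?_⟩
    by_contra hne
    obtain ⟨h, t, ht⟩ := hQ M (f x - φ f) (sub_ne_zero.2 hne)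
    obtain ⟨G, hG⟩ := Module.Injective.extension_property R Q X (s → M) ι hι (h ∘ₗ f)
    apply ht
    rw [map_sub, map_sub, sub_eq_zero]
    have h1 : t (G (ι x)) = φ (t ∘ₗ G ∘ₗ ι) := by rw [hx]; exact hq (t ∘ₗ G)
    rw [hG] at h1
    have h2 : G (ι x) = h (f x) := LinearMap.congr_fun hG x
    rw [h2] at h1
    rw [h1]
    exact φ.map_smul (t ∘ₗ h : Module.End R M) f

end Evaluation

/-- A module that is reflexive with respect to `M`, and whose dual is finitely generated projective
over `End(M)`, belongs to `add M`. -/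
theorem inAdd_of_evalEnd_bijective {R : Type u} [Ring R] {M X : ModuleCat.{u} R}
    (hX : Function.Bijective (evalEnd R M X))
    [Module.Finite (Module.End R M) (X →ₗ[R] M)] [Module.Projective (Module.End R M) (X →ₗ[R] M)] :
    InAdd R M X := by
  obtain ⟨n, π, hπ⟩ := Module.Finite.exists_fin' (Module.End R M) (X →ₗ[R] M)
  obtain ⟨σ, hσ⟩ := Module.projective_lifting_property π LinearMap.id hπ
  let e := LinearEquiv.ofBijective _ hX
  let ρ : (Fin n → M) →ₗ[R] ((X →ₗ[R] M) →ₗ[Module.End R M] M) :=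
    { toFun := fun m ↦
        { toFun := fun f ↦ ∑ i, σ f i (m i)
          map_add' := fun f g ↦ by simp [Finset.sum_add_distrib]
          map_smul' := fun γ f ↦ by simp [Finset.smul_sum] }
      map_add' := fun f g ↦ by ext; simp [Finset.sum_add_distrib]
      map_smul' := fun γ f ↦ by ext; simp [Finset.smul_sum] }
  refine .of_linearMap (n := n) (LinearMap.pi fun i ↦ π (Pi.single i 1)) (e.symm.toLinearMap ∘ₗ ρ)
    (LinearMap.ext fun x ↦ ?_)
  refine (LinearEquiv.symm_apply_eq e).2 (LinearMap.ext fun f ↦ ?_)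
  have h1 : π (σ f) = f := LinearMap.congr_fun hσ f
  have h2 := π.apply_eq_sum_smul_single (σ f)
  change ∑ i, σ f i (π (Pi.single i 1) x) = f x
  conv_rhs => rw [← h1, h2]
  simp

/-- The global dimension of `End(M)` is at most two when `M` is an additive generator. -/
theorem gldimLE_two_of_inAdd {R : Type u} [Ring R] {M : ModuleCat.{u} R} [Module.Finite R M]
    [IsNoetherianRing (Module.End R M)]
    (hM : ∀ N : ModuleCat.{u} R, Module.Finite R N → InAdd R M N) :
    gldimLE (Module.End R M) 2 := by
  intro N hN
  obtain ⟨n, π, hπ⟩ := Module.Finite.exists_fin' (Module.End R M) N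
  obtain ⟨m, ρ, hρ⟩ := Module.Finite.exists_fin' (Module.End R M) (LinearMap.ker π)
  refine ⟨ModuleCat.of _ (Fin n → Module.End R M), ModuleCat.of _ (LinearMap.ker π),
    ModuleCat.ofHom (LinearMap.ker π).subtype, ModuleCat.ofHom π, inferInstance,
    Subtype.val_injective, hπ, LinearMap.exact_subtype_ker_map π,
    ModuleCat.of _ (Fin m → Module.End R M), ModuleCat.of _ (LinearMap.ker ρ),
    ModuleCat.ofHom (LinearMap.ker ρ).subtype, ModuleCat.ofHom ρ, inferInstance,
    Subtype.val_injective, hρ, LinearMap.exact_subtype_ker_map ρ, ?_⟩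
  refine (IsProjective.iff_projective _).1 ?_
  let ψ : (Fin m → Module.End R M) →ₗ[Module.End R M] (Fin n → Module.End R M) :=
    (LinearMap.ker π).subtype ∘ₗ ρ
  let a (m) : (Fin m → Module.End R M) ≃ₗ[Module.End R M] ((Fin m → M) →ₗ[R] M) :=
    LinearMap.lsum R (fun _ ↦ M) (Module.End R M)
  let d : (Fin n → M) →ₗ[R] (Fin m → M) := LinearMap.pi fun j ↦ a n (ψ (Pi.single j 1))
  have hd (γ) : a n (ψ γ) = a m γ ∘ₗ d := by
    rw [← LinearEquiv.coe_coe, ← LinearMap.comp_apply, LinearMap.apply_eq_sum_smul_single]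
    ext x
    simp [a, d]
  obtain ⟨l, s, r, hsr⟩ := (hM (ModuleCat.of R ((Fin m → M) ⧸ LinearMap.range d))
    (inferInstanceAs (Module.Finite R ((Fin m → M) ⧸ LinearMap.range d)))).exists_linearMap
  have hproj := projective_hom_of_retract s r hsr
  have hker (γ) : γ ∈ LinearMap.ker ρ ↔ a m γ ∘ₗ d = 0 := by
    rw [← hd, LinearMap.mem_ker]
    simp [ψ]
  let E : (((Fin m → M) ⧸ LinearMap.range d) →ₗ[R] M) →ₗ[Module.End R M] LinearMap.ker ρ :=
    LinearMap.codRestrict _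
      ((a m).symm.toLinearMap ∘ₗ LinearMap.lcomp (Module.End R M) M (LinearMap.range d).mkQ)
      fun h ↦ by
        rw [hker, LinearMap.comp_apply, LinearEquiv.coe_coe, LinearEquiv.apply_symm_apply]
        change (h ∘ₗ (LinearMap.range d).mkQ) ∘ₗ d = 0
        rw [LinearMap.comp_assoc, LinearMap.range_mkQ_comp, LinearMap.comp_zero]
  refine Module.Projective.of_equiv' (LinearEquiv.ofBijective E ⟨?_, ?_⟩)
  · intro f g hfg
    have h1 := (a m).symm.injective (congrArg Subtype.val hfg)
    exact Submodule.linearMap_qext _ h1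
  · rintro ⟨γ, hγ⟩
    have hle := LinearMap.range_le_ker_iff.2 ((hker γ).1 hγ)
    exact ⟨(LinearMap.range d).liftQ (a m γ) hle,
      Subtype.ext ((LinearEquiv.symm_apply_eq (a m)).2 (Submodule.liftQ_mkQ _ _ hle))⟩

/-- If `End(M)` has global dimension at most two and `M` is a generator, then the dual of a finitely
generated module with respect to `M` is projective over `End(M)`. -/
theorem projective_hom_of_gldimLE_two {R : Type u} [Ring R] [IsNoetherianRing R]
    {M X : ModuleCat.{u} R} [Module.Finite R X] [Module.Finite (Module.End R M) M]
    (hgen : InAdd R M (ModuleCat.of R R)) (hgl : gldimLE (Module.End R M) 2) :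
    Module.Projective (Module.End R M) (X →ₗ[R] M) := by
  obtain ⟨l, s, r, hsr⟩ := hgen.exists_linearMap
  have hfree (b : ℕ) : Module.Projective (Module.End R M) ((Fin b → R) →ₗ[R] M) := by
    refine projective_hom_of_retract (ι := Fin b × Fin l)
      (LinearMap.pi fun i ↦ LinearMap.proj i.2 ∘ₗ s ∘ₗ LinearMap.proj i.1)
      (LinearMap.pi fun i ↦ r ∘ₗ LinearMap.pi fun j ↦ LinearMap.proj (i, j)) ?_
    exact LinearMap.ext fun x ↦ funext fun i ↦ LinearMap.congr_fun hsr (x i)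
  obtain ⟨b, p, hp⟩ := Module.Finite.exists_fin' R X
  obtain ⟨a, p', hp'⟩ := Module.Finite.exists_fin' R (LinearMap.ker p)
  let d : (Fin a → R) →ₗ[R] (Fin b → R) := (LinearMap.ker p).subtype ∘ₗ p'
  have hd : LinearMap.range d = LinearMap.ker p := by
    rw [LinearMap.range_comp, LinearMap.range_eq_top.2 hp', Submodule.map_top,
      Submodule.range_subtype]
  let β := LinearMap.lcomp (Module.End R M) M d
  have hfin : Module.Finite (Module.End R M) ((Fin a → R) →ₗ[R] M) :=
    .equiv (LinearMap.lsum R (fun _ : Fin a ↦ R) (Module.End R M) ≪≫ₗ .refl _ _)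
  have := projective_ker_of_pdLE_two β (hgl _ (inferInstanceAs (Module.Finite _ (_ ⧸ _))))
  let α : (X →ₗ[R] M) →ₗ[Module.End R M] LinearMap.ker β :=
    LinearMap.codRestrict _ (LinearMap.lcomp (Module.End R M) M p) fun f ↦ by
      refine LinearMap.ext fun x ↦ ?_
      have hx : p (d x) = 0 := hd.le ⟨x, rfl⟩
      change f (p (d x)) = 0
      rw [hx, map_zero]
  refine Module.Projective.of_equiv' (LinearEquiv.ofBijective α ⟨?_, ?_⟩).symm
  · intro f g hfg
    exact (LinearMap.cancel_right hp).1 (congrArg Subtype.val hfg)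
  · rintro ⟨g, hg⟩
    have hle : LinearMap.ker p ≤ LinearMap.ker g := by
      rw [← hd, LinearMap.range_le_ker_iff]
      exact hg
    refine ⟨(LinearMap.ker p).liftQ g hle ∘ₗ (p.quotKerEquivOfSurjective hp).symm, ?_⟩
    refine Subtype.ext (LinearMap.ext fun x ↦ ?_)
    change (LinearMap.ker p).liftQ g hle ((p.quotKerEquivOfSurjective hp).symm (p x)) = g x
    rw [show (p.quotKerEquivOfSurjective hp).symm (p x) = (LinearMap.ker p).mkQ x from
      (LinearEquiv.symm_apply_eq _).2 rfl]
    rfl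

/-- The linear maps between two modules over a `k`-algebra that are finite over the Noetherian ring
`k` form a finite `k`-module. -/
theorem finite_linearMap_of_isNoetherianRing (k : Type*) {R M N : Type*} [CommRing k]
    [IsNoetherianRing k] [Ring R] [Algebra k R] [AddCommGroup M] [Module R M] [Module k M]
    [IsScalarTower k R M] [AddCommGroup N] [Module R N] [Module k N] [IsScalarTower k R N]
    [Module.Finite k M] [Module.Finite k N] : Module.Finite k (M →ₗ[R] N) :=
  .of_injective (LinearMap.restrictScalarsₗ k R M N k) (LinearMap.restrictScalars_injective k)

/-- **Auslander.** A non-semisimple Artin algebra is of finite representation type if and only if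
its representation dimension is at most two. -/
theorem finiteRepType_iff_repdim_le_two
    (k : Type u) (Λ : Type u) [CommRing k] [IsArtinianRing k] [Ring Λ] [Algebra k Λ]
    [Module.Finite k Λ] (hns : ¬ IsSemisimpleRing Λ) :
    FiniteRepType Λ ↔ repdimLE Λ 2 := by
  have := IsNoetherianRing.of_finite k Λ
  have := IsArtinianRing.of_finite k Λ
  have hfin (X M : ModuleCat.{u} Λ) [Module.Finite Λ X] [Module.Finite Λ M] :
      IsNoetherianRing (Module.End Λ M) ∧ Module.Finite (Module.End Λ M) M ∧
        Module.Finite (Module.End Λ M) (X →ₗ[Λ] M) := by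
    let _ : Module k M := Module.compHom M (algebraMap k Λ)
    let _ : Module k X := Module.compHom X (algebraMap k Λ)
    have : IsScalarTower k Λ M := .of_algebraMap_smul fun _ _ ↦ rfl
    have : IsScalarTower k Λ X := .of_algebraMap_smul fun _ _ ↦ rfl
    have : Module.Finite k M := .trans Λ M
    have : Module.Finite k X := .trans Λ X
    have : Module.Finite k (Module.End Λ M) := finite_linearMap_of_isNoetherianRing k
    have : Module.Finite k (X →ₗ[Λ] M) := finite_linearMap_of_isNoetherianRing k
    exact ⟨.of_finite k _, .of_restrictScalars_finite k _ _, .of_restrictScalars_finite k _ _⟩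
  constructor
  · rintro ⟨M, hM, h⟩
    have := (hfin M M).1
    exact ⟨M, hM, ⟨h _ (inferInstanceAs (Module.Finite Λ Λ)), fun I hI _ ↦ h I hI⟩,
      gldimLE_two_of_inAdd h⟩
  · rintro ⟨M, hM, ⟨hgen, hcogen⟩, hgl⟩
    refine ⟨M, hM, fun X hX ↦ ?_⟩
    obtain ⟨-, _, _⟩ := hfin X M
    obtain ⟨Q, hQfin, hQinj, hQ⟩ := exists_finite_injective_cogenerator k Λ
    have : Module.Injective Λ Q := Module.injective_module_of_injective_object Λ Q
    obtain ⟨n, s, r, hsr⟩ := (hcogen Q hQfin hQinj).exists_linearMap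
    have := projective_hom_of_gldimLE_two (X := X) hgen hgl
    refine inAdd_of_evalEnd_bijective (evalEnd_bijective (Q := Q) fun N _ _ y hy ↦ ?_)
    obtain ⟨h, hh⟩ := hQ N y hy
    have hs : s (h y) ≠ 0 := fun h0 ↦ hh <| by
      rw [← LinearMap.id_apply (R := Λ) (h y), ← hsr, LinearMap.comp_apply, h0, map_zero]
    obtain ⟨i, hi⟩ := Function.ne_iff.1 hs
    exact ⟨h, LinearMap.proj i ∘ₗ s, hi⟩
end
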